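/- Conditional excess-distortion entropy sandwich: R_X^c(d,ε) ≤ H_X^c(d,ε) ≤ R_X^c(d,ε) + log₂(R_X^c(d,ε) + 2) + 1 + log₂ e bits, where H_X^c(d,ε) is the infimum of H(Y) over (possibly randomized) kernels P_{Y|X} satisfying P(d(X,Y) > d | X = x) ≤ ε for all x in the support of P_X. -/

import Mathlib

noncomputable section

/-- `q` is a probability mass function on the finite alphabet `α`. -/
def isPMF {α : Type*} [Fintype α] (q : α → ℝ) : Prop :=
  (∀ a, 0 ≤ q a) ∧ ∑ a, q a = 1

/-- Shannon entropy (in bits) of a pmf on a finite alphabet. -/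
def ent {α : Type*} [Fintype α] (q : α → ℝ) : ℝ :=
  ∑ a, -(q a * Real.logb 2 (q a))

/-- Relative entropy (Kullback–Leibler divergence, in bits) between pmfs. -/
def klDiv {α : Type*} [Fintype α] (μ ν : α → ℝ) : ℝ :=
  ∑ a, μ a * Real.logb 2 (μ a / ν a)

/-- Probability, under `Q`, of the distortion-`D` ball around `x`:
`Q(B_D(x)) = Q {y : df x y ≤ D}`. -/
def probBall {X Y : Type*} [Fintype Y] (Q : Y → ℝ) (df : X → Y → ℝ) (D : ℝ) (x : X) : ℝ :=
  ∑ y, if df x y ≤ D then Q y else 0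

/-- Output marginal `P_Y` induced by input pmf `p` and kernel `K`. -/
def marg {X Y : Type*} [Fintype X] [Fintype Y] (p : X → ℝ) (K : X → Y → ℝ) : Y → ℝ :=
  fun y => ∑ x, p x * K x y

/-- Mutual information (in bits) `I(X;Y)` of the joint law `p ⊗ K`,
written as `E_X [ D(K(X) ‖ P_Y) ]`. -/
def mutInfo {X Y : Type*} [Fintype X] [Fintype Y] (p : X → ℝ) (K : X → Y → ℝ) : ℝ :=
  ∑ x, p x * klDiv (K x) (marg p K)

/-- Binary relative entropy `d(α‖q)` (in bits). -/
def bdiv (a q : ℝ) : ℝ :=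
  a * Real.logb 2 (a / q) + (1 - a) * Real.logb 2 ((1 - a) / (1 - q))


open Finset in
lemma aux_jensen (b σ m : ℝ) (hb : 0 < b) (hbs : b ≤ σ) (hm : 0 ≤ m) :
    b * Real.log (m + 1) + (σ - b) * Real.log (m + 1 + σ / b) ≤ σ * Real.log (m + σ / b) := by
  have hσ : 0 < σ := lt_of_lt_of_le hb hbs
  have hr : 0 < σ / b := by positivity
  have hZ : 0 < m + σ / b := by positivity
  have h1 := Real.log_le_sub_one_of_pos (show 0 < (m + 1) / (m + σ / b) by positivity)
  have h2 := Real.log_le_sub_one_of_pos (show 0 < (m + 1 + σ / b) / (m + σ / b) by positivity)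
  rw [Real.log_div (by positivity) (by positivity)] at h1 h2
  have e1 := mul_le_mul_of_nonneg_left h1 hb.le
  have e2 := mul_le_mul_of_nonneg_left h2 (sub_nonneg.2 hbs)
  have key : b * ((m + 1) / (m + σ / b) - 1) + (σ - b) * ((m + 1 + σ / b) / (m + σ / b) - 1) = 0 := by
    have hZ' : m * b + σ ≠ 0 := by positivity
    field_simp
    ring
  nlinarith

lemma aux_ord {X Y : Type*} (c : X → ℝ) (hc : ∀ x, 0 ≤ c x) (Q : Y → ℝ) (B : X → Y → Prop) :
    ∀ (n : ℕ) (S : Finset Y) (_ : S.card = n) (m : ℕ) (A : Finset X),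
      (∀ y ∈ S, 0 < Q y) → (∀ x ∈ A, ∃ y ∈ S, B x y) → (∃ y : Y, True) →
      ∃ (N : Y → ℕ) (f : X → Y), Set.InjOn N S ∧ (∀ y ∈ S, m + 1 ≤ N y) ∧
        (S.Nonempty → ∃ y ∈ S, N y = m + 1) ∧ (∀ x ∈ A, f x ∈ S ∧ B x (f x)) ∧
        ∑ x ∈ A, c x * Real.log (N (f x)) ≤
          ∑ x ∈ A, c x * Real.log (m + (∑ y ∈ S, Q y) / (∑ y ∈ S, open Classical in if B x y then Q y else 0)) := by
  classical
  intro n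
  induction n with
  | zero =>
    intro S hS m A hQ hA hY
    obtain ⟨y0, -⟩ := hY
    have hS0 : S = ∅ := Finset.card_eq_zero.1 hS
    subst hS0
    have hA0 : A = ∅ := by
      apply Finset.eq_empty_of_forall_notMem
      intro x hx
      obtain ⟨y, hy, -⟩ := hA x hx
      simp at hy
    subst hA0
    exact ⟨fun _ => 0, fun _ => y0, by simp, by simp, by simp, by simp, by simp⟩
  | succ n ih =>
    intro S hS m A hQ hA hY
    have hSne : S.Nonempty := by
      rw [← Finset.card_pos]; omega
    set σ := ∑ y ∈ S, Q y with hσ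
    have hσpos : 0 < σ := Finset.sum_pos hQ hSne
    set b : X → ℝ := fun x => ∑ y ∈ S, if B x y then Q y else 0 with hbdef
    have hbpos : ∀ x ∈ A, 0 < b x := by
      intro x hx
      obtain ⟨y, hy, hxy⟩ := hA x hx
      apply Finset.sum_pos'
      · intro z hz
        split_ifs
        · exact (hQ z hz).le
        · exact le_rfl
      · exact ⟨y, hy, by simpa [hxy] using hQ y hy⟩
    have hbσ : ∀ x, b x ≤ σ := by
      intro x
      apply Finset.sum_le_sum
      intro z hz
      split_ifs
      · exact le_rfl
      · exact (hQ z hz).le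
    have hsplit : ∀ x, ∑ y ∈ S, (if B x y then 0 else Q y) = σ - b x := by
      intro x
      rw [hσ, hbdef, ← Finset.sum_sub_distrib]
      apply Finset.sum_congr rfl
      intro y _
      split_ifs <;> simp
    set F : Y → ℝ := fun y => ∑ x ∈ A, c x *
      (if B x y then Real.log (m + 1) else Real.log (m + 1 + (σ - Q y) / b x)) with hF
    have havg : ∃ y ∈ S, Q y * F y ≤ Q y * ∑ x ∈ A, c x * Real.log (m + σ / b x) := by
      apply Finset.exists_le_of_sum_le hSne
      rw [← Finset.sum_mul, ← hσ, Finset.mul_sum]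
      simp only [hF, Finset.mul_sum]
      rw [Finset.sum_comm]
      apply Finset.sum_le_sum
      intro x hx
      have hb := hbpos x hx
      calc _ ≤ ∑ y ∈ S, c x * ((if B x y then Q y else 0) * Real.log (m + 1) +
              (if B x y then 0 else Q y) * Real.log (m + 1 + σ / b x)) := by
            apply Finset.sum_le_sum
            intro y hy
            rw [mul_left_comm]
            apply mul_le_mul_of_nonneg_left _ (hc x)
            by_cases h : B x y
            · simp [h]
            · simp only [h, if_false, zero_mul, zero_add]
              apply mul_le_mul_of_nonneg_left _ (hQ y hy).le
              have h1 : Q y ≤ σ := Finset.single_le_sum (fun z hz => (hQ z hz).le) hy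
              have h2 : 0 ≤ (σ - Q y) / b x := div_nonneg (by linarith) hb.le
              apply Real.log_le_log (by positivity)
              have := hQ y hy
              gcongr
              linarith
        _ = c x * (b x * Real.log (m + 1) + (σ - b x) * Real.log (m + 1 + σ / b x)) := by
            rw [← Finset.mul_sum, Finset.sum_add_distrib, ← Finset.sum_mul, ← Finset.sum_mul, hsplit]
        _ ≤ c x * (σ * Real.log (m + σ / b x)) :=
            mul_le_mul_of_nonneg_left (aux_jensen _ _ _ hb (hbσ x) (by positivity)) (hc x)
        _ = _ := by ring
    obtain ⟨y, hyS, hy⟩ := havg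
    have hy := le_of_mul_le_mul_left hy (hQ y hyS)
    obtain ⟨N, f, hN, hNm, -, hf, hle⟩ := ih (S.erase y) (by rw [Finset.card_erase_of_mem hyS]; omega)
      (m + 1) (A.filter (fun x => ¬ B x y)) (fun z hz => hQ z (Finset.mem_of_mem_erase hz))
      (by
        intro x hx
        rw [Finset.mem_filter] at hx
        obtain ⟨z, hz, hxz⟩ := hA x hx.1
        refine ⟨z, Finset.mem_erase.2 ⟨?_, hz⟩, hxz⟩
        rintro rfl
        exact hx.2 hxz) hY
    have hval : ∀ z ∈ S, z ≠ y → m + 2 ≤ N z := fun z hz hzy => hNm z (Finset.mem_erase.2 ⟨hzy, hz⟩)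
    refine ⟨Function.update N y (m + 1), fun x => if B x y then y else f x, ?_, ?_, ?_, ?_, ?_⟩
    · intro u hu v hv huv
      by_cases h1 : u = y <;> by_cases h2 : v = y
      · rw [h1, h2]
      · have := hval v hv h2
        simp [h1, h2] at huv
        omega
      · have := hval u hu h1
        simp [h1, h2] at huv
        omega
      · simp [h1, h2] at huv
        exact hN (by simp [h1]; exact hu) (by simp [h2]; exact hv) huv
    · intro z hz
      by_cases h : z = y
      · simp [h]
      · have := hval z hz h
        simp [h]
        omega
    · intro _
      exact ⟨y, hyS, by simp⟩
    · intro x hx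
      by_cases h : B x y
      · simp [h, hyS]
      · have := hf x (by simp [hx, h])
        simp only [h, if_false]
        exact ⟨Finset.mem_of_mem_erase this.1, this.2⟩
    · refine le_trans ?_ hy
      simp only [hF]
      rw [← Finset.sum_filter_add_sum_filter_not A (fun x => B x y)]
      rw [← Finset.sum_filter_add_sum_filter_not A (fun x => B x y) (fun x => c x *
        (if B x y then Real.log (m + 1) else Real.log (m + 1 + (σ - Q y) / b x)))]
      apply add_le_add
      · apply le_of_eq
        apply Finset.sum_congr rfl
        intro x hx
        have := (Finset.mem_filter.1 hx).2
        simp [this]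
      · refine le_trans (le_of_eq ?_) (le_trans hle (le_of_eq ?_))
        · apply Finset.sum_congr rfl
          intro x hx
          have hx' := (Finset.mem_filter.1 hx).2
          have hne : f x ≠ y := by
            have := (hf x hx).1
            exact Finset.ne_of_mem_erase this
          simp [hx', hne]
        · apply Finset.sum_congr rfl
          intro x hx
          have hx' := (Finset.mem_filter.1 hx).2
          have e1 : ∑ z ∈ S.erase y, Q z = σ - Q y := by
            rw [hσ, ← Finset.add_sum_erase S Q hyS]; ring
          have e2 : ∑ z ∈ S.erase y, (if B x z then Q z else 0) = b x := by
            rw [hbdef]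
            simp only
            rw [← Finset.add_sum_erase S _ hyS]; simp [hx']
          rw [e1, e2]
          simp [hx']

lemma aux_gibbs {α : Type*} [Fintype α] (μ ν : α → ℝ) (hμ : ∀ a, 0 ≤ μ a) (hν : ∀ a, 0 ≤ ν a)
    (h1 : ∑ a, μ a = 1) (h2 : ∑ a, ν a ≤ 1) (hac : ∀ a, ν a = 0 → μ a = 0) :
    0 ≤ ∑ a, μ a * Real.logb 2 (μ a / ν a) := by
  have hl : 0 < Real.log 2 := Real.log_pos (by norm_num)
  have key : ∀ a, (μ a - ν a) / Real.log 2 ≤ μ a * Real.logb 2 (μ a / ν a) := by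
    intro a
    rw [Real.logb, mul_div_assoc']
    gcongr
    rcases (hμ a).eq_or_lt with h | h
    · rw [← h]; simpa using hν a
    · have hn : 0 < ν a := lt_of_le_of_ne (hν a) (fun h' => h.ne' (hac a h'.symm))
      have := Real.one_sub_inv_le_log_of_pos (div_pos h hn)
      have := mul_le_mul_of_nonneg_left this h.le
      have e : μ a * (1 - (μ a / ν a)⁻¹) = μ a - ν a := by field_simp
      linarith
  calc (0:ℝ) ≤ ∑ a, (μ a - ν a) / Real.log 2 := by
        rw [← Finset.sum_div, Finset.sum_sub_distrib]
        exact div_nonneg (by linarith) hl.le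
    _ ≤ _ := Finset.sum_le_sum (fun a _ => key a)

lemma aux_zeta (t : ℝ) (ht : 0 < t) (M : ℕ) :
    ∑ k ∈ Finset.range M, ((k : ℝ) + 1) ^ (-(1 + t)) ≤ 1 + 1 / t := by
  have : ∀ M : ℕ, ∑ k ∈ Finset.range (M + 1), ((k : ℝ) + 1) ^ (-(1 + t)) ≤
      1 + 1 / t - 1 / t * ((M : ℝ) + 1) ^ (-t) := by
    intro M
    induction M with
    | zero => simp
    | succ M ih =>
      rw [Finset.sum_range_succ]
      have hs : ((M : ℝ) + 1 + 1) ^ (-(1 + t)) ≤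
          1 / t * ((M : ℝ) + 1) ^ (-t) - 1 / t * ((M : ℝ) + 1 + 1) ^ (-t) := by
        set a : ℝ := (M : ℝ) + 1 with ha
        have hapos : 0 < a := by positivity
        have hb : 0 < a + 1 := by positivity
        -- Bernoulli
        have hber : 1 + t * (1 / (a + 1)) ≤ (a / (a + 1)) ^ (-t) := by
          rw [Real.rpow_def_of_pos (by positivity)]
          have h1 := Real.log_le_sub_one_of_pos (show 0 < a / (a + 1) by positivity)
          have h2 : a / (a + 1) - 1 = - (1 / (a + 1)) := by field_simp; ring
          have h3 := Real.add_one_le_exp (Real.log (a / (a + 1)) * -t)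
          rw [h2] at h1
          nlinarith
        have e1 : a ^ (-t) = (a / (a + 1)) ^ (-t) * (a + 1) ^ (-t) := by
          rw [← Real.mul_rpow (by positivity) (by positivity)]
          congr 1
          field_simp
        have e2 : (a + 1) ^ (-(1 + t)) = (a + 1) ^ (-t) * (1 / (a + 1)) := by
          rw [show -(1 + t) = -t - 1 by ring, Real.rpow_sub_one hb.ne']
          ring
        rw [e1, e2]
        have hp : 0 < (a + 1) ^ (-t) := by positivity
        have := mul_le_mul_of_nonneg_right hber hp.le
        have h5 : (a + 1) ^ (-t) * (1 / (a + 1)) =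
          1 / t * ((1 + t * (1 / (a + 1))) * (a + 1) ^ (-t)) - 1 / t * (a + 1) ^ (-t) := by
          field_simp; ring
        rw [h5]
        gcongr
      push_cast
      linarith
  cases M with
  | zero => simp; positivity
  | succ M =>
    refine (this M).trans ?_
    have : 0 ≤ 1 / t * ((M : ℝ) + 1) ^ (-t) := by positivity
    linarith

lemma aux_zeta' {Y : Type*} (S : Finset Y) (N : Y → ℕ) (hN : Set.InjOn N S) (h1 : ∀ y ∈ S, 1 ≤ N y)
    (t : ℝ) (ht : 0 < t) : ∑ y ∈ S, (N y : ℝ) ^ (-(1 + t)) ≤ 1 + 1 / t := by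
  classical
  have hinj : Set.InjOn (fun y => N y - 1) S := by
    intro u hu v hv h
    have := h1 u hu
    have := h1 v hv
    apply hN hu hv
    simp only at h
    omega
  calc ∑ y ∈ S, (N y : ℝ) ^ (-(1 + t)) = ∑ k ∈ S.image (fun y => N y - 1), ((k : ℝ) + 1) ^ (-(1 + t)) := by
        rw [Finset.sum_image hinj]
        apply Finset.sum_congr rfl
        intro y hy
        rw [Nat.cast_sub (h1 y hy)]
        simp
    _ ≤ ∑ k ∈ Finset.range ((S.image (fun y => N y - 1)).sup id + 1), ((k : ℝ) + 1) ^ (-(1 + t)) := by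
        apply Finset.sum_le_sum_of_subset_of_nonneg
        · intro k hk
          rw [Finset.mem_range]
          have := Finset.le_sup (f := id) hk
          simp only [id] at this ⊢
          omega
        · intros; positivity
    _ ≤ _ := aux_zeta t ht _

lemma aux_marg_ge {X Y : Type*} [Fintype X] [Fintype Y] (p : X → ℝ) (K : X → Y → ℝ)
    (hp : isPMF p) (hK : ∀ x, isPMF (K x)) (x : X) (y : Y) : p x * K x y ≤ marg p K y :=
  Finset.single_le_sum (f := fun x => p x * K x y)
    (fun z _ => mul_nonneg (hp.1 z) ((hK z).1 y)) (Finset.mem_univ x)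

lemma aux_marg_swap {X Y : Type*} [Fintype X] [Fintype Y] (p : X → ℝ) (K : X → Y → ℝ) (g : Y → ℝ) :
    ∑ y, marg p K y * g y = ∑ x, p x * ∑ y, K x y * g y := by
  simp only [marg, Finset.sum_mul, Finset.mul_sum]
  rw [Finset.sum_comm]
  simp only [mul_assoc]

lemma aux_marg_pmf {X Y : Type*} [Fintype X] [Fintype Y] (p : X → ℝ) (K : X → Y → ℝ)
    (hp : isPMF p) (hK : ∀ x, isPMF (K x)) : isPMF (marg p K) := by
  constructor
  · intro y
    exact Finset.sum_nonneg (fun z _ => mul_nonneg (hp.1 z) ((hK z).1 y))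
  · have := aux_marg_swap p K (fun _ => 1)
    simp only [mul_one] at this
    rw [this]
    simp [(hK _).2, hp.2]

lemma aux_ac {X Y : Type*} [Fintype X] [Fintype Y] (p : X → ℝ) (K : X → Y → ℝ)
    (hp : isPMF p) (hK : ∀ x, isPMF (K x)) (x : X) (hx : 0 < p x) (y : Y)
    (h : marg p K y = 0) : K x y = 0 := by
  have h1 := aux_marg_ge p K hp hK x y
  rw [h] at h1
  have h2 := (hK x).1 y
  nlinarith

lemma aux_mut_nonneg {X Y : Type*} [Fintype X] [Fintype Y] (p : X → ℝ) (K : X → Y → ℝ)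
    (hp : isPMF p) (hK : ∀ x, isPMF (K x)) : 0 ≤ mutInfo p K := by
  apply Finset.sum_nonneg
  intro x _
  rcases (hp.1 x).eq_or_lt with h | h
  · simp [← h]
  · have hm := aux_marg_pmf p K hp hK
    exact mul_nonneg h.le (aux_gibbs _ _ (hK x).1 hm.1 (hK x).2 hm.2.le (aux_ac p K hp hK x h))

lemma aux_mut_le {X Y : Type*} [Fintype X] [Fintype Y] (p : X → ℝ) (K : X → Y → ℝ)
    (hp : isPMF p) (hK : ∀ x, isPMF (K x)) : mutInfo p K ≤ ent (marg p K) := by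
  have hm := aux_marg_pmf p K hp hK
  have e : ent (marg p K) = ∑ x, p x * ∑ y, K x y * (-Real.logb 2 (marg p K y)) := by
    rw [← aux_marg_swap]; simp [ent]
  rw [e]
  apply Finset.sum_le_sum
  intro x _
  rcases (hp.1 x).eq_or_lt with h | h
  · simp [← h]
  · apply mul_le_mul_of_nonneg_left _ h.le
    apply Finset.sum_le_sum
    intro y _
    rcases ((hK x).1 y).eq_or_lt with h' | h'
    · simp [← h']
    · apply mul_le_mul_of_nonneg_left _ h'.le
      have hQ : marg p K y ≠ 0 := fun hh => h'.ne' (aux_ac p K hp hK x h y hh)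
      rw [Real.logb_div h'.ne' hQ]
      have h1 : K x y ≤ 1 := by
        rw [← (hK x).2]
        exact Finset.single_le_sum (f := K x) (fun z _ => (hK x).1 z) (Finset.mem_univ y)
      have := Real.logb_nonpos (b := 2) (by norm_num) h'.le h1
      linarith

lemma aux_dp {X Y : Type*} [Fintype Y] (df : X → Y → ℝ) (D ε : ℝ) (x : X) (k Q : Y → ℝ)
    (hk : isPMF k) (hQ : isPMF Q) (hac : ∀ y, Q y = 0 → k y = 0) (hq : 0 < probBall Q df D x)
    (ha : 1 - ε ≤ probBall k df D x) :
    (1 - ε) * Real.logb 2 (1 / probBall Q df D x) ≤ klDiv k Q + 1 := by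
  set q := probBall Q df D x with hqd
  have hq1 : q ≤ 1 := by
    rw [← hQ.2]
    apply Finset.sum_le_sum
    intro y _
    have := hQ.1 y
    split_ifs <;> linarith
  set ν : Y → ℝ := fun y => (if df x y ≤ D then Q y else 0) * (1 / (2 * q)) +
    (Q y - (if df x y ≤ D then Q y else 0)) * (1 / 2) with hν
  have hν1 : ∀ y, df x y ≤ D → ν y = Q y / (2 * q) := by
    intro y h; simp [hν, h]; ring
  have hν2 : ∀ y, ¬ df x y ≤ D → ν y = Q y / 2 := by
    intro y h; simp [hν, h]; ring
  have hsum : ∑ y, ν y ≤ 1 := by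
    simp only [hν]
    rw [Finset.sum_add_distrib, ← Finset.sum_mul, ← Finset.sum_mul, Finset.sum_sub_distrib, hQ.2]
    change q * (1 / (2 * q)) + (1 - q) * (1 / 2) ≤ 1
    have : q * (1 / (2 * q)) = 1 / 2 := by field_simp
    linarith
  have hg := aux_gibbs k ν hk.1 (by
      intro y
      have := hQ.1 y
      by_cases h : df x y ≤ D
      · rw [hν1 y h]; positivity
      · rw [hν2 y h]; positivity) hk.2 hsum (by
      intro y hy
      apply hac
      by_cases h : df x y ≤ D
      · rw [hν1 y h] at hy
        rcases div_eq_zero_iff.1 hy with h | h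
        · exact h
        · linarith
      · rw [hν2 y h] at hy; linarith)
  have e : ∑ a, k a * Real.logb 2 (k a / ν a) = klDiv k Q + 1 + probBall k df D x * Real.logb 2 q := by
    rw [klDiv, ← hk.2, probBall, Finset.sum_mul, ← Finset.sum_add_distrib, ← Finset.sum_add_distrib]
    apply Finset.sum_congr rfl
    intro y _
    by_cases h0 : k y = 0
    · simp [h0]
    have hQy : Q y ≠ 0 := fun h => h0 (hac y h)
    have l2 : Real.logb 2 2 = 1 := Real.logb_self_eq_one (by norm_num)
    by_cases h : df x y ≤ D
    · rw [hν1 y h, Real.logb_div h0 (by positivity), Real.logb_div h0 hQy,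
        Real.logb_div hQy (by positivity), Real.logb_mul (by norm_num) hq.ne', l2]
      simp [h]; ring
    · rw [hν2 y h, Real.logb_div h0 (by positivity), Real.logb_div h0 hQy,
        Real.logb_div hQy (by positivity), l2]
      simp [h]; ring
  rw [e] at hg
  have hl : Real.logb 2 q ≤ 0 := Real.logb_nonpos (by norm_num) hq.le hq1
  rw [one_div, Real.logb_inv]
  nlinarith

lemma aux_ent {Y : Type*} [Fintype Y] (r : Y → ℝ) (hr : isPMF r) (S : Finset Y) (N : Y → ℕ)
    (hN : Set.InjOn N S) (h1 : ∀ y ∈ S, 1 ≤ N y) (hrS : ∀ y, y ∉ S → r y = 0) (t : ℝ) (ht : 0 < t) :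
    ent r ≤ ∑ y, r y * ((1 + t) * Real.logb 2 (N y) + Real.logb 2 (1 + 1 / t)) := by
  classical
  set C := 1 + 1 / t with hC
  have hCp : 0 < C := by positivity
  set ν : Y → ℝ := fun y => if y ∈ S then (N y : ℝ) ^ (-(1 + t)) / C else 0 with hν
  have hνp : ∀ y ∈ S, 0 < ν y := by
    intro y hy
    have : (0:ℝ) < N y := by exact_mod_cast h1 y hy
    simp only [hν, hy, if_true]
    positivity
  have hg := aux_gibbs r ν hr.1 (by
      intro y
      by_cases hy : y ∈ S
      · exact (hνp y hy).le
      · simp [hν, hy]) hr.2 (by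
      simp only [hν]
      rw [Finset.sum_ite_mem, Finset.univ_inter, ← Finset.sum_div, div_le_one hCp]
      exact aux_zeta' S N hN h1 t ht) (by
      intro y hy
      apply hrS
      intro hy'
      exact (hνp y hy').ne' hy)
  have e : ∑ y, r y * Real.logb 2 (r y / ν y) =
      ∑ y, r y * ((1 + t) * Real.logb 2 (N y) + Real.logb 2 C) - ent r := by
    rw [ent, ← Finset.sum_sub_distrib]
    apply Finset.sum_congr rfl
    intro y _
    by_cases h0 : r y = 0
    · simp [h0]
    have hy : y ∈ S := by
      by_contra h; exact h0 (hrS y h)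
    have hNp : (0:ℝ) < N y := by exact_mod_cast h1 y hy
    rw [Real.logb_div h0 (hνp y hy).ne']
    simp only [hν, hy, if_true]
    rw [Real.logb_div (by positivity) hCp.ne', Real.logb_rpow_eq_mul_logb_of_pos hNp]
    ring
  linarith

lemma aux_main {X Y : Type*} [Fintype X] [Fintype Y] [Nonempty Y]
    (p : X → ℝ) (df : X → Y → ℝ) (D ε : ℝ) (hε0 : 0 < ε) (hε1 : ε < 1)
    (hp : isPMF p) (K : X → Y → ℝ) (hK : ∀ x, isPMF (K x))
    (hKb : ∀ x, 0 < p x → 1 - ε ≤ probBall (K x) df D x) :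
    ∃ K' : X → Y → ℝ, (∀ x, isPMF (K' x)) ∧
        (∀ x, 0 < p x → 1 - ε ≤ probBall (K' x) df D x) ∧
        ent (marg p K') ≤ mutInfo p K + Real.logb 2 (mutInfo p K + 2) + 1 + Real.logb 2 (Real.exp 1) := by
  classical
  set Q := marg p K with hQd
  have hQ := aux_marg_pmf p K hp hK
  rw [← hQd] at hQ
  set I := mutInfo p K with hI
  have hI0 : 0 ≤ I := aux_mut_nonneg p K hp hK
  have hq : ∀ x, 0 < p x → 0 < probBall Q df D x := by
    intro x hx
    have : p x * probBall (K x) df D x ≤ probBall Q df D x := by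
      rw [probBall, probBall, Finset.mul_sum]
      apply Finset.sum_le_sum
      intro y _
      split_ifs
      · exact aux_marg_ge p K hp hK x y
      · simp
    have h2 := mul_le_mul_of_nonneg_left (hKb x hx) hx.le
    have h3 : 0 < p x * (1 - ε) := mul_pos hx (by linarith)
    linarith
  set S : Finset Y := Finset.univ.filter (fun y => 0 < Q y) with hS
  set A : Finset X := Finset.univ.filter (fun x => 0 < p x) with hA
  have hQS : ∀ y, y ∉ S → Q y = 0 := by
    intro y hy
    simp [hS] at hy
    exact le_antisymm hy (hQ.1 y)
  have hsumS : ∑ y ∈ S, Q y = 1 := by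
    rw [← hQ.2]
    exact Finset.sum_subset (Finset.subset_univ _) (fun y _ hy => hQS y hy)
  have hballS : ∀ x, ∑ y ∈ S, (if df x y ≤ D then Q y else 0) = probBall Q df D x := by
    intro x
    refine Finset.sum_subset (Finset.subset_univ _) (fun y _ hy => ?_)
    simp [hQS y hy]
  have hSne : S.Nonempty := by
    by_contra h
    rw [Finset.not_nonempty_iff_eq_empty] at h
    rw [h] at hsumS
    simp at hsumS
  obtain ⟨N, f, hN, hN1, hy1, hf, hle⟩ := aux_ord (fun x => p x * (1 - ε))
    (fun x => mul_nonneg (hp.1 x) (by linarith)) Q (fun x y => df x y ≤ D) _ S rfl 0 A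
    (fun y hy => (Finset.mem_filter.1 hy).2)
    (by
      intro x hx
      have h := hq x (Finset.mem_filter.1 hx).2
      rw [← hballS] at h
      by_contra hcon
      push Not at hcon
      rw [Finset.sum_eq_zero] at h
      · exact lt_irrefl _ h
      · intro y hy
        rw [if_neg (not_le.2 (hcon y hy))])
    ⟨Classical.arbitrary Y, trivial⟩
  obtain ⟨y1, hy1S, hy1⟩ := hy1 hSne
  simp only [zero_add, Nat.cast_zero] at hN1 hy1 hle
  set K' : X → Y → ℝ := fun x y => (1 - ε) * (if y = f x then 1 else 0) + ε * (if y = y1 then 1 else 0)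
    with hK'
  have hK'sum : ∀ x (g : Y → ℝ), ∑ y, K' x y * g y = (1 - ε) * g (f x) + ε * g y1 := by
    intro x g
    simp [hK', add_mul, Finset.sum_add_distrib]
  have hK'p : ∀ x, isPMF (K' x) := by
    intro x
    constructor
    · intro y
      have : 0 ≤ 1 - ε := by linarith
      simp only [hK']
      positivity
    · have := hK'sum x (fun _ => 1)
      simp only [mul_one] at this
      rw [this]; ring
  refine ⟨K', hK'p, ?_, ?_⟩
  · intro x hx
    have hfx := (hf x (by simp [hA, hx])).2
    have := hK'sum x (fun y => if df x y ≤ D then 1 else 0)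
    simp only [mul_ite, mul_one, mul_zero] at this
    rw [probBall, this, if_pos hfx]
    split_ifs <;> linarith
  · have hT : 0 < I + 1 := by linarith
    have he := aux_ent (marg p K') (aux_marg_pmf p K' hp hK'p) S N hN hN1 (by
      intro y hy
      apply Finset.sum_eq_zero
      intro x _
      rcases (hp.1 x).eq_or_lt with h | h
      · simp [← h]
      · have h1 : y ≠ f x := by
          rintro rfl
          exact hy (hf x (by simp [hA, h])).1
        have h2 : y ≠ y1 := by
          rintro rfl
          exact hy hy1S
        simp [hK', h1, h2]) (1 / (I + 1)) (by positivity)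
    rw [aux_marg_swap] at he
    have hL : ∑ x, p x * (1 - ε) * Real.logb 2 (N (f x)) ≤ I + 1 := by
      have s1 : ∑ x, p x * (1 - ε) * Real.logb 2 (N (f x)) =
          (∑ x ∈ A, p x * (1 - ε) * Real.log (N (f x))) / Real.log 2 := by
        rw [Finset.sum_div]
        symm
        simp only [Real.logb, mul_div_assoc]
        refine Finset.sum_subset (Finset.subset_univ _) (fun x _ hx => ?_)
        simp [hA] at hx
        simp [le_antisymm hx (hp.1 x)]
      have hl : 0 < Real.log 2 := Real.log_pos (by norm_num)
      rw [s1]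
      refine (div_le_div_of_nonneg_right hle hl.le).trans ?_
      have s2 : I + 1 = ∑ x, p x * (klDiv (K x) Q + 1) := by
        simp only [mul_add, mul_one, Finset.sum_add_distrib, hp.2]
        rfl
      rw [s2, Finset.sum_div]
      calc _ ≤ ∑ x ∈ A, p x * (klDiv (K x) Q + 1) := by
            apply Finset.sum_le_sum
            intro x hx
            have hx := (Finset.mem_filter.1 hx).2
            have := aux_dp df D ε x (K x) Q (hK x) hQ (aux_ac p K hp hK x hx) (hq x hx) (hKb x hx)
            have := mul_le_mul_of_nonneg_left this hx.le
            refine le_trans (le_of_eq ?_) this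
            rw [← hballS, hsumS, Real.logb, mul_div_assoc, mul_assoc]
        _ = _ := by
            refine Finset.sum_subset (Finset.subset_univ _) (fun x _ hx => ?_)
            simp [hA] at hx
            simp [le_antisymm hx (hp.1 x)]
    have e1 : ∑ x, p x * ∑ y, K' x y * ((1 + 1 / (I + 1)) * Real.logb 2 (N y) +
        Real.logb 2 (1 + 1 / (1 / (I + 1)))) =
        (1 + 1 / (I + 1)) * ∑ x, p x * (1 - ε) * Real.logb 2 (N (f x)) + Real.logb 2 (I + 2) := by
      have e0 : 1 + 1 / (1 / (I + 1)) = I + 2 := by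
        rw [one_div_one_div]; ring
      rw [e0, Finset.mul_sum]
      have : Real.logb 2 (I + 2) = ∑ x, p x * Real.logb 2 (I + 2) := by
        rw [← Finset.sum_mul, hp.2, one_mul]
      conv_rhs => rw [this]
      rw [← Finset.sum_add_distrib]
      apply Finset.sum_congr rfl
      intro x _
      rw [hK'sum, hy1]
      simp only [Nat.cast_one, Real.logb_one]
      ring
    rw [e1] at he
    have h3 := mul_le_mul_of_nonneg_left hL (show 0 ≤ 1 + 1 / (I + 1) by positivity)
    have h4 : (1 + 1 / (I + 1)) * (I + 1) = I + 2 := by field_simp; ring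
    have h5 : 1 ≤ Real.logb 2 (Real.exp 1) := by
      rw [Real.le_logb_iff_rpow_le (by norm_num) (Real.exp_pos 1), Real.rpow_one]
      have := Real.add_one_le_exp 1
      linarith
    linarith

/-- conditional excess-distortion entropy sandwich:
`R_X^c(d,ε) ≤ H_X^c(d,ε) ≤ R_X^c(d,ε) + log₂(R_X^c(d,ε) + 2) + 1 + log₂ e` bits,
where `H_X^c(d,ε)` is the infimum of `H(Y)` over (possibly randomized) kernels with
`P(d(X,Y) > D | X = x) ≤ ε` on the support of `p`. -/
theorem cond_excess_entropy_sandwich {X Y : Type*} [Fintype X] [Fintype Y] [Nonempty Y]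
    (p : X → ℝ) (df : X → Y → ℝ) (D ε : ℝ) (hε0 : 0 < ε) (hε1 : ε < 1)
    (hp : isPMF p) (hball : ∀ x, 0 < p x → ∃ y, df x y ≤ D)
    (Rc Hc : ℝ)
    (hRc : Rc = sInf {r : ℝ | ∃ K : X → Y → ℝ, (∀ x, isPMF (K x)) ∧
        (∀ x, 0 < p x → 1 - ε ≤ probBall (K x) df D x) ∧ r = mutInfo p K})
    (hHc : Hc = sInf {r : ℝ | ∃ K : X → Y → ℝ, (∀ x, isPMF (K x)) ∧
        (∀ x, 0 < p x → 1 - ε ≤ probBall (K x) df D x) ∧ r = ent (marg p K)}) :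
    Rc ≤ Hc ∧
      Hc ≤ Rc + Real.logb 2 (Rc + 2) + 1 + Real.logb 2 (Real.exp 1) := by
  classical
  set SR := {r : ℝ | ∃ K : X → Y → ℝ, (∀ x, isPMF (K x)) ∧
        (∀ x, 0 < p x → 1 - ε ≤ probBall (K x) df D x) ∧ r = mutInfo p K} with hSR
  set SH := {r : ℝ | ∃ K : X → Y → ℝ, (∀ x, isPMF (K x)) ∧
        (∀ x, 0 < p x → 1 - ε ≤ probBall (K x) df D x) ∧ r = ent (marg p K)} with hSH
  obtain ⟨K0, hK0, hK0b⟩ : ∃ K : X → Y → ℝ, (∀ x, isPMF (K x)) ∧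
        (∀ x, 0 < p x → 1 - ε ≤ probBall (K x) df D x) := by
    have : ∀ x, ∃ y, 0 < p x → df x y ≤ D := by
      intro x
      by_cases h : 0 < p x
      · obtain ⟨y, hy⟩ := hball x h
        exact ⟨y, fun _ => hy⟩
      · exact ⟨Classical.arbitrary Y, fun h' => absurd h' h⟩
    choose f hf using this
    refine ⟨fun x y => if y = f x then 1 else 0, fun x => ⟨fun y => ?_, ?_⟩, fun x hx => ?_⟩
    · positivity
    · simp
    · have : probBall (fun y => if y = f x then (1:ℝ) else 0) df D x = 1 := by
        rw [probBall, Finset.sum_eq_single (f x)]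
        · simp [hf x hx]
        · intro y _ hy; simp [hy]
        · simp
      rw [this]; linarith
  have hSRne : SR.Nonempty := ⟨_, K0, hK0, hK0b, rfl⟩
  have hSHne : SH.Nonempty := ⟨_, K0, hK0, hK0b, rfl⟩
  have hSR0 : ∀ r ∈ SR, 0 ≤ r := by
    rintro r ⟨K, hK, -, rfl⟩
    exact aux_mut_nonneg p K hp hK
  have hSRb : BddBelow SR := ⟨0, hSR0⟩
  have hSHb : BddBelow SH := by
    refine ⟨0, ?_⟩
    rintro r ⟨K, hK, -, rfl⟩
    exact (aux_mut_nonneg p K hp hK).trans (aux_mut_le p K hp hK)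
  constructor
  · rw [hHc]
    apply le_csInf hSHne
    rintro r ⟨K, hK, hKb, rfl⟩
    rw [hRc]
    exact (csInf_le hSRb ⟨K, hK, hKb, rfl⟩).trans (aux_mut_le p K hp hK)
  · have hR0 : 0 ≤ Rc := by
      rw [hRc]; exact le_csInf hSRne hSR0
    have hcl : Rc ∈ closure SR := by
      rw [hRc]; exact csInf_mem_closure hSRne hSRb
    obtain ⟨u, hu, hlim⟩ := mem_closure_iff_seq_limit.1 hcl
    have hg : Filter.Tendsto (fun n => u n + Real.logb 2 (u n + 2) + 1 + Real.logb 2 (Real.exp 1))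
        Filter.atTop (nhds (Rc + Real.logb 2 (Rc + 2) + 1 + Real.logb 2 (Real.exp 1))) := by
      have h1 : Filter.Tendsto (fun n => Real.logb 2 (u n + 2)) Filter.atTop
          (nhds (Real.logb 2 (Rc + 2))) := by
        simp only [Real.logb]
        exact ((hlim.add_const 2).log (by linarith)).div_const _
      exact ((hlim.add h1).add_const 1).add_const _
    apply ge_of_tendsto' hg
    intro n
    obtain ⟨K, hK, hKb, hr⟩ := hu n
    obtain ⟨K', hK', hKb', hle⟩ := aux_main p df D ε hε0 hε1 hp K hK hKb
    rw [hr, hHc]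
    exact (csInf_le hSHb ⟨K', hK', hKb', rfl⟩).trans hle
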